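/- Let S be a nonnegative real m×n matrix, and suppose S(k,ℓ) = tr(A_kᵀ B_ℓ) for all k,ℓ, where A_1,…,A_m and B_1,…,B_n are real positive semidefinite q×q matrices. Then there exist vectors ξ_1,…,ξ_m, η_1,…,η_n ∈ ℝ^q such that for all k,ℓ: the inner product ⟨A_k ξ_k, B_ℓ η_ℓ⟩ equals 0 if and only if S(k,ℓ) = 0. -/

import Mathlib

open Matrix

/-- Finitely many nonzero vectors admit a common vector orthogonal to none of them. -/
lemma exists_forall_dotProduct_ne_zero {ι κ K : Type*} [Finite ι] [Fintype κ] [Field K] [Infinite K]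
    (v : ι → κ → K) (hv : ∀ i, v i ≠ 0) : ∃ x : κ → K, ∀ i, x ⬝ᵥ v i ≠ 0 := by
  classical
  obtain ⟨f, hf⟩ := Module.exists_dual_forall_apply_ne_zero (K := K) v hv
  refine ⟨(dotProductEquiv K κ).symm f, fun i h => hf i ?_⟩
  rw [← h, ← dotProductEquiv_apply_apply, LinearEquiv.apply_symm_apply]

/-- Finitely many nonzero matrices admit a pair of vectors at which none of the associated bilinear
forms vanishes. -/
lemma exists_forall_dotProduct_mulVec_ne_zero {ι κ κ' K : Type*} [Finite ι] [Fintype κ] [Fintype κ']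
    [Field K] [Infinite K] (M : ι → Matrix κ κ' K) (hM : ∀ i, M i ≠ 0) :
    ∃ (x : κ → K) (y : κ' → K), ∀ i, x ⬝ᵥ (M i *ᵥ y) ≠ 0 := by
  have hrow : ∀ i, ∃ a, M i a ≠ 0 := fun i => Function.ne_iff.mp (hM i)
  choose a ha using hrow
  obtain ⟨y, hy⟩ := exists_forall_dotProduct_ne_zero (fun i => M i (a i)) ha
  have hMy : ∀ i, M i *ᵥ y ≠ 0 := fun i h => hy i (by
    rw [dotProduct_comm]
    exact congrFun h (a i))
  obtain ⟨x, hx⟩ := exists_forall_dotProduct_ne_zero _ hMy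
  exact ⟨x, y, hx⟩

open scoped MatrixOrder in
/-- Positive semidefinite matrices are trace-orthogonal exactly when their product vanishes. -/
lemma Matrix.PosSemidef.trace_mul_eq_zero_iff {κ : Type*} [Fintype κ] {A B : Matrix κ κ ℝ}
    (hA : A.PosSemidef) (hB : B.PosSemidef) : (A * B).trace = 0 ↔ A * B = 0 := by
  classical
  refine ⟨fun h => ?_, fun h => by rw [h, trace_zero]⟩
  obtain ⟨C, rfl⟩ := CStarAlgebra.nonneg_iff_eq_star_mul_self.mp hA.nonneg
  obtain ⟨D, rfl⟩ := CStarAlgebra.nonneg_iff_eq_star_mul_self.mp hB.nonneg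
  rw [star_eq_conjTranspose, star_eq_conjTranspose] at h ⊢
  have hCD : C * Dᴴ = 0 := by
    rw [← trace_mul_conjTranspose_self_eq_zero_iff, ← h, conjTranspose_mul,
      conjTranspose_conjTranspose, Matrix.mul_assoc Cᴴ, trace_mul_comm Cᴴ]
    simp only [Matrix.mul_assoc]
  rw [Matrix.mul_assoc, ← Matrix.mul_assoc C, hCD, Matrix.zero_mul, Matrix.mul_zero]

theorem exists_vectors_support_realization {m n q : ℕ}
    (S : Matrix (Fin m) (Fin n) ℝ) (hS : ∀ k ℓ, 0 ≤ S k ℓ)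
    (A : Fin m → Matrix (Fin q) (Fin q) ℝ) (B : Fin n → Matrix (Fin q) (Fin q) ℝ)
    (hA : ∀ k, (A k).PosSemidef) (hB : ∀ ℓ, (B ℓ).PosSemidef)
    (hfac : ∀ k ℓ, S k ℓ = ((A k)ᵀ * B ℓ).trace) :
    ∃ (ξ : Fin m → Fin q → ℝ) (η : Fin n → Fin q → ℝ),
      ∀ k ℓ, ((A k).mulVec (ξ k)) ⬝ᵥ ((B ℓ).mulVec (η ℓ)) = 0 ↔ S k ℓ = 0 := by
  obtain ⟨x, y, hxy⟩ := exists_forall_dotProduct_mulVec_ne_zero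
    (fun p : {p : Fin m × Fin n // (A p.1)ᵀ * B p.2 ≠ 0} => (A p.1.1)ᵀ * B p.1.2) (fun p => p.2)
  refine ⟨fun _ => x, fun _ => y, fun k ℓ => ?_⟩
  have hform : (A k *ᵥ x) ⬝ᵥ (B ℓ *ᵥ y) = x ⬝ᵥ (((A k)ᵀ * B ℓ) *ᵥ y) := by
    rw [← mulVec_mulVec, dotProduct_mulVec x, vecMul_transpose]
  rw [hform, hfac, (hA k).transpose.trace_mul_eq_zero_iff (hB ℓ)]
  refine ⟨fun h => ?_, fun h => by rw [h, zero_mulVec, dotProduct_zero]⟩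
  by_contra hne
  exact hxy ⟨(k, ℓ), hne⟩ h
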